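/- arXiv:1105.4207 — 4 statements merged into one kernel-verified Lean document; each statement's English description precedes it below -/
import Mathlib

section
/- In the degenerate affine BMW algebra 𝓦_k the following 'tangle' relations hold for 1 ≤ i ≤ k−2: (i) e_{i+1} e_i = e_{i+1} t_{s_i} t_{s_{i+1}}; (ii) e_i e_{i+1} = t_{s_{i+1}} t_{s_i} e_{i+1}; (iii) t_{s_i} e_{i+1} e_i = t_{s_{i+1}} e_i; (iv) e_{i+1} e_i t_{s_{i+1}} = e_{i+1} t_{s_i}. -/
/-- The simple transposition `sᵢ = (i, i+1)` (0-indexed) in the symmetric group on `Fin k`.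
In the paper's 1-indexed notation, `sw k (i-1) _` is `s_i`. -/
def sw (k i : ℕ) (h : i + 1 < k) : Equiv.Perm (Fin k) :=
  Equiv.swap ⟨i, Nat.lt_of_succ_lt h⟩ ⟨i + 1, h⟩

/-- A `C`-algebra `A` together with elements satisfying the defining relations of the
degenerate affine BMW algebra `𝓦ₖ` with parameters `ε` and `z₀⁽ℓ⁾`.  Everything is
0-indexed: the paper's `s_i`, `y_i`, `e_i` (for `1 ≤ i`) are `sw k (i-1) _`, `y (i-1)`,
`e (i-1) _` here.  The field `e_def` is the equation `t_{s_i} y_i = y_{i+1} t_{s_i} - (1 - e_i)`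
defining `e_i`. -/
structure DegAffBMW (C : Type*) [CommRing C] (k : ℕ) (ε : C) (z₀ : ℕ → C)
    (A : Type*) [Ring A] [Algebra C A] where
  t : Equiv.Perm (Fin k) → A
  κ₀ : A
  κ₁ : A
  y : ℕ → A
  e : ∀ i : ℕ, i + 1 < k → A
  t_one : t 1 = 1
  t_mul : ∀ u v, t u * t v = t (u * v)
  y_comm : ∀ i j, i < k → j < k → y i * y j = y j * y i
  κ_comm : κ₀ * κ₁ = κ₁ * κ₀
  κ₀_y : ∀ i, i < k → κ₀ * y i = y i * κ₀
  κ₁_y : ∀ i, i < k → κ₁ * y i = y i * κ₁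
  κ₀_t : ∀ i (h : i + 1 < k), κ₀ * t (sw k i h) = t (sw k i h) * κ₀
  κ₁_braid : ∀ h : 1 < k,
      κ₁ * t (sw k 0 h) * κ₁ * t (sw k 0 h) = t (sw k 0 h) * κ₁ * t (sw k 0 h) * κ₁
  κ₁_t : ∀ j (h : j + 1 < k), j ≠ 0 → κ₁ * t (sw k j h) = t (sw k j h) * κ₁
  t_yy : ∀ i (h : i + 1 < k),
      t (sw k i h) * (y i + y (i + 1)) = (y i + y (i + 1)) * t (sw k i h)
  y_t : ∀ i j (h : i + 1 < k), j < k → j ≠ i → j ≠ i + 1 →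
      y j * t (sw k i h) = t (sw k i h) * y j
  γ_rel : ∀ i (h : i + 2 < k),
      t (sw k i (by omega)) * t (sw k (i + 1) h) *
          (y (i + 1) - t (sw k i (by omega)) * y i * t (sw k i (by omega))) *
          t (sw k (i + 1) h) * t (sw k i (by omega)) =
        y (i + 2) - t (sw k (i + 1) h) * y (i + 1) * t (sw k (i + 1) h)
  e_def : ∀ i (h : i + 1 < k),
      t (sw k i h) * y i = y (i + 1) * t (sw k i h) - (1 - e i h)
  e_t : ∀ i (h : i + 1 < k), e i h * t (sw k i h) = ε • e i h
  t_e : ∀ i (h : i + 1 < k), t (sw k i h) * e i h = ε • e i h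
  ete_up : ∀ i (h : i + 1 < k) (h' : i + 2 < k),
      e i h * t (sw k (i + 1) h') * e i h = ε • e i h
  ete_down : ∀ i (h : i + 1 < k) (h' : i - 1 + 1 < k), 1 ≤ i →
      e i h * t (sw k (i - 1) h') * e i h = ε • e i h
  eye : ∀ (h : 1 < k) (ℓ : ℕ), e 0 h * y 0 ^ ℓ * e 0 h = z₀ ℓ • e 0 h
  e_yy : ∀ i (h : i + 1 < k), e i h * (y i + y (i + 1)) = 0
  yy_e : ∀ i (h : i + 1 < k), (y i + y (i + 1)) * e i h = 0

theorem sw_mul_self (k i : ℕ) (h : i + 1 < k) : sw k i h * sw k i h = 1 :=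
  Equiv.swap_mul_self _ _

theorem sw_braid (k i : ℕ) (h : i + 2 < k) :
    sw k i (by omega) * sw k (i + 1) h * sw k i (by omega) =
      sw k (i + 1) h * sw k i (by omega) * sw k (i + 1) h := by
  have hxy : (⟨i, by omega⟩ : Fin k) ≠ ⟨i + 1, by omega⟩ := by simp
  have hxz : (⟨i, by omega⟩ : Fin k) ≠ ⟨i + 2, h⟩ := by simp
  have hyz : (⟨i + 1, by omega⟩ : Fin k) ≠ ⟨i + 2, h⟩ := by simp
  have h₁ := Equiv.swap_mul_swap_mul_swap hxy hxz
  have h₂ := Equiv.swap_mul_swap_mul_swap hyz.symm hxz.symm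
  rw [Equiv.swap_comm (⟨i + 1, by omega⟩ : Fin k) ⟨i, by omega⟩,
    Equiv.swap_comm (⟨i + 2, h⟩ : Fin k) ⟨i + 1, by omega⟩,
    Equiv.swap_comm (⟨i, by omega⟩ : Fin k) ⟨i + 2, h⟩] at h₂
  exact h₂.trans h₁.symm

namespace DegAffBMW

variable {C : Type*} [CommRing C] {k : ℕ} {ε : C} {z₀ : ℕ → C} {A : Type*} [Ring A] [Algebra C A]

theorem t_sw_mul_self (B : DegAffBMW C k ε z₀ A) (i : ℕ) (h : i + 1 < k) :
    B.t (sw k i h) * B.t (sw k i h) = 1 := by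
  rw [B.t_mul, sw_mul_self, B.t_one]

theorem t_sw_braid (B : DegAffBMW C k ε z₀ A) (i : ℕ) (h : i + 2 < k) :
    B.t (sw k i (by omega)) * B.t (sw k (i + 1) h) * B.t (sw k i (by omega)) =
      B.t (sw k (i + 1) h) * B.t (sw k i (by omega)) * B.t (sw k (i + 1) h) := by
  simp only [B.t_mul, sw_braid]

theorem gamma_eq (B : DegAffBMW C k ε z₀ A) (i : ℕ) (h : i + 1 < k) :
    B.y (i + 1) - B.t (sw k i h) * B.y i * B.t (sw k i h) = B.t (sw k i h) - ε • B.e i h := by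
  rw [B.e_def, sub_mul, sub_mul, mul_assoc, B.t_sw_mul_self, B.e_t]
  simp

theorem e_succ_eq (B : DegAffBMW C k ε z₀ A) (hε : ε * ε = 1) (i : ℕ) (h : i + 2 < k) :
    B.e (i + 1) h = B.t (sw k i (by omega)) * B.t (sw k (i + 1) h) * B.e i (by omega) *
      B.t (sw k (i + 1) h) * B.t (sw k i (by omega)) := by
  have hγ := B.γ_rel i h
  rw [B.gamma_eq, B.gamma_eq, mul_sub, sub_mul, sub_mul, t_sw_braid, mul_assoc _ _ (B.t (sw k (i + 1) h)),
    B.t_sw_mul_self, mul_one, mul_assoc _ _ (B.t (sw k i _)), B.t_sw_mul_self, mul_one,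
    sub_right_inj] at hγ
  simpa [smul_smul, hε] using (congrArg (ε • ·) hγ).symm

end DegAffBMW

/-- the 'tangle' relations (2.28)–(2.29) in the degenerate affine BMW algebra
`𝓦ₖ` (0-indexed: the paper's range `1 ≤ i ≤ k-2` is `i+2 < k` here):
(i) `e_{i+1} eᵢ = e_{i+1} t_{sᵢ} t_{s_{i+1}}`; (ii) `eᵢ e_{i+1} = t_{s_{i+1}} t_{sᵢ} e_{i+1}`;
(iii) `t_{sᵢ} e_{i+1} eᵢ = t_{s_{i+1}} eᵢ`; (iv) `e_{i+1} eᵢ t_{s_{i+1}} = e_{i+1} t_{sᵢ}`. -/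
theorem degenerate_affine_BMW_tangle_relations
    (C : Type*) [CommRing C] (k : ℕ) (ε : C) (z₀ : ℕ → C)
    (A : Type*) [Ring A] [Algebra C A]
    (hk : 3 ≤ k) (hε : ε = 1 ∨ ε = -1)
    (B : DegAffBMW C k ε z₀ A) :
    ∀ i (h : i + 2 < k),
      B.e (i + 1) h * B.e i (by omega) =
          B.e (i + 1) h * B.t (sw k i (by omega)) * B.t (sw k (i + 1) h) ∧
      B.e i (by omega) * B.e (i + 1) h =
          B.t (sw k (i + 1) h) * B.t (sw k i (by omega)) * B.e (i + 1) h ∧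
      B.t (sw k i (by omega)) * B.e (i + 1) h * B.e i (by omega) =
          B.t (sw k (i + 1) h) * B.e i (by omega) ∧
      B.e (i + 1) h * B.e i (by omega) * B.t (sw k (i + 1) h) =
          B.e (i + 1) h * B.t (sw k i (by omega)) := by
  intro i h
  have hε₂ : ε * ε = 1 := by rcases hε with rfl | rfl <;> simp
  have hs := B.t_sw_mul_self i (by omega)
  have hr := B.t_sw_mul_self (i + 1) h
  have hse (x : A) : x * B.t (sw k i (by omega)) * B.t (sw k i (by omega)) = x := by
    rw [mul_assoc, hs, mul_one]
  have hre (x : A) : x * B.t (sw k (i + 1) h) * B.t (sw k (i + 1) h) = x := by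
    rw [mul_assoc, hr, mul_one]
  have hf := B.e_succ_eq hε₂ i h
  have hfe : B.e (i + 1) h * B.e i (by omega) =
      B.t (sw k i (by omega)) * B.t (sw k (i + 1) h) * B.e i (by omega) := by
    rw [hf, mul_assoc _ _ (B.e i _), B.t_e, mul_smul_comm, mul_assoc, mul_assoc,
      ← mul_assoc (B.e i _), B.ete_up, mul_smul_comm, smul_smul, hε₂, one_smul]
  have hef : B.e i (by omega) * B.e (i + 1) h =
      B.e i (by omega) * B.t (sw k (i + 1) h) * B.t (sw k i (by omega)) := by
    rw [hf]
    simp only [← mul_assoc]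
    rw [B.e_t, smul_mul_assoc, smul_mul_assoc, B.ete_up, smul_smul, hε₂, one_smul]
  have hfsr : B.e (i + 1) h * B.e i (by omega) =
      B.e (i + 1) h * B.t (sw k i (by omega)) * B.t (sw k (i + 1) h) := by
    rw [hfe, hf, hse, hre]
  refine ⟨hfsr, ?_, ?_, ?_⟩
  · rw [hef, hf]
    simp only [← mul_assoc, hse, hr, one_mul]
  · rw [mul_assoc, hfe, ← mul_assoc, ← mul_assoc, hs, one_mul]
  · rw [hfsr, hre]
end

section
/- (Second intertwiner-like identity, degenerate case.) Assume 2 is invertible in C. Write u_j⁺ = 1/(u−y_j). In the ring of formal Laurent series in u⁻¹ with coefficients in 𝓦_k, for every 1 ≤ i ≤ k−1: ( u_{i+1}⁺ + t_{s_i} − e_i·(1/(2u−(y_i+y_{i+1}))) ) − u_i⁺ ( u_{i+1}⁺ + t_{s_i} − e_i·(1/(2u−(y_i+y_{i+1}))) ) u_i⁺ = ( t_{s_i} u_i⁺ t_{s_i} + t_{s_i} − e_i·(1/(2u−(y_i+y_{i+1}))) ) − u_{i+1}⁺ ( e_i u_i⁺ e_i + ε e_i − e_i·(1/(2u−(y_i+y_{i+1})))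 ) u_{i+1}⁺. -/
noncomputable section

/-- `1/(u - a) := Σ_{ℓ≥1} a^{ℓ-1} u^{-ℓ}`, a formal Laurent series in `u⁻¹`
(an element of `LaurentSeries A = HahnSeries ℤ A` whose variable is `u⁻¹`). -/
def invU {A : Type*} [Ring A] (a : A) : LaurentSeries A :=
  HahnSeries.ofPowerSeries ℤ A (PowerSeries.mk fun n => if n = 0 then 0 else a ^ (n - 1))

/-- `1/(2u - a) := Σ_{ℓ≥1} a^{ℓ-1} (2u)^{-ℓ}` (needs `2` invertible in `C`). -/
def inv2U (C : Type*) [CommRing C] [Invertible (2 : C)]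
    {A : Type*} [Ring A] [Algebra C A] (a : A) : LaurentSeries A :=
  HahnSeries.ofPowerSeries ℤ A
    (PowerSeries.mk fun n => if n = 0 then 0 else ((⅟2 : C) ^ n) • a ^ (n - 1))

/-- The variable `u` itself (the inverse of the Laurent series variable `u⁻¹`). -/
def Uvar (A : Type*) [Ring A] : LaurentSeries A := HahnSeries.single (-1 : ℤ) 1

/-- A constant Laurent series. -/
def cst {A : Type*} [Ring A] (a : A) : LaurentSeries A := HahnSeries.C a

end

/-- The second intertwiner identity in an arbitrary ring, where `P` and `Q` are the resolvents
of `a` and `b` at a central element `U` and `V` is a central inverse of `2 * U`. -/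
theorem second_intertwiner_of_resolvents {R : Type*} [Ring R] {a b T E U V P Q S : R}
    (hUT : U * T = T * U) (hUE : U * E = E * U)
    (hUV : U * V + U * V = 1) (hVC : ∀ x, V * x = x * V)
    (hP : (U - a) * P = 1) (hP' : P * (U - a) = 1)
    (hQ : (U - b) * Q = 1) (hQ' : Q * (U - b) = 1)
    (hPQ : P * Q = Q * P) (hT : T * T = 1) (hTa : T * a = b * T - (1 - E))
    (hET : E * T = S) (hTE : T * E = S)
    (hE : E * (a + b) = 0) (hE' : (a + b) * E = 0) :
    (Q + T - E * V) - P * (Q + T - E * V) * P =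
      (T * P * T + T - E * V) - Q * (E * P * E + S - E * V) * Q := by
  have haT : a * T = T * b - (1 - E) := by
    calc a * T = T * (T * a) * T := by rw [← mul_assoc, hT, one_mul]
      _ = T * b * (T * T) - T * T + T * E * T := by rw [hTa]; noncomm_ring
      _ = T * b - (1 - E) := by
        rw [hTE, ← hET, mul_assoc E, hT]; noncomm_ring
  have hTP : T * P = Q * T - Q * P + Q * E * P := by
    have h1 : (U - b) * T = T * (U - a) - 1 + E := by
      rw [sub_mul, mul_sub, hTa, hUT]; abel
    calc T * P = Q * ((U - b) * T) * P := by rw [← mul_assoc, hQ', one_mul]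
      _ = Q * T * ((U - a) * P) - Q * P + Q * E * P := by rw [h1]; noncomm_ring
      _ = _ := by rw [hP, mul_one]
  have hPT : P * T = T * Q - P * Q + P * E * Q := by
    have h1 : T * (U - b) = (U - a) * T - 1 + E := by
      rw [sub_mul, mul_sub, haT, hUT]; abel
    calc P * T = P * (T * (U - b)) * Q := by
          rw [← mul_assoc, mul_assoc (P * T), hQ, mul_one]
      _ = (P * (U - a)) * T * Q - P * Q + P * E * Q := by rw [h1]; noncomm_ring
      _ = _ := by rw [hP', one_mul]
  have hEPQ : E * P * Q = V * (E * (P + Q)) := by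
    have h1 : P + Q = (U + U - (a + b)) * (P * Q) := by
      calc P + Q = (U - b) * Q * P + (U - a) * P * Q := by rw [hP, hQ, one_mul, one_mul]
        _ = (U - b) * (Q * P) + (U - a) * (P * Q) := by simp only [mul_assoc]
        _ = _ := by rw [← hPQ]; noncomm_ring
    have h2 : E * (P + Q) = (U + U) * (E * P * Q) := by
      calc E * (P + Q) = (E * U + E * U) * (P * Q) - E * (a + b) * (P * Q) := by
            rw [h1]; noncomm_ring
        _ = _ := by rw [hE, ← hUE]; noncomm_ring
    rw [h2, ← mul_assoc, mul_add, hVC, hUV, one_mul]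
  have hPQE : P * Q * E = (P + Q) * E * V := by
    have h1 : P + Q = P * Q * (U + U - (a + b)) := by
      calc P + Q = P * (Q * (U - b)) + Q * (P * (U - a)) := by rw [hP', hQ', mul_one, mul_one]
        _ = P * Q * (U - b) + Q * P * (U - a) := by simp only [mul_assoc]
        _ = _ := by rw [← hPQ]; noncomm_ring
    have h2 : (P + Q) * E = P * Q * E * (U + U) := by
      calc (P + Q) * E = P * Q * (U * E + U * E) - P * Q * ((a + b) * E) := by
            rw [h1]; noncomm_ring
        _ = _ := by rw [hE', hUE]; noncomm_ring
    rw [h2, mul_assoc _ (U + U), add_mul, hUV, mul_one]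
  have hPTP : P * T * P = P * Q * T - P * Q * P + P * Q * E * P := by
    rw [mul_assoc, hTP]; noncomm_ring
  have hTPT : T * P * T = Q - P * Q * T + (Q * S * Q - Q * (E * P * Q) + Q * E * P * E * Q) := by
    calc T * P * T = Q * (T * T) - Q * P * T + Q * E * (P * T) := by rw [hTP]; noncomm_ring
      _ = Q - P * Q * T + Q * E * (T * Q - P * Q + P * E * Q) := by rw [hT, hPT, hPQ, mul_one]
      _ = _ := by rw [← hET]; noncomm_ring
  calc (Q + T - E * V) - P * (Q + T - E * V) * P
      = Q + T - E * V - P * Q * P - P * T * P + P * E * (V * P) := by noncomm_ring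
    _ = Q + T - E * V - P * Q * T - Q * E * P * V := by
      rw [hPTP, hPQE, hVC P, mul_assoc ((P + Q) * E), hVC P]; noncomm_ring
    _ = T * P * T + T - E * V - Q * E * P * E * Q - Q * S * Q + Q * E * (V * Q) := by
      rw [hTPT, hEPQ, hVC, hVC Q]; noncomm_ring
    _ = _ := by noncomm_ring

/-- The geometric series is a left inverse of `1 - a X`. -/
theorem mk_pow_mul_one_sub {A : Type*} [Ring A] (a : A) :
    (PowerSeries.mk fun n => a ^ n) * (1 - PowerSeries.C a * PowerSeries.X) = 1 := by
  ext n
  rw [mul_sub, mul_one, ← mul_assoc]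
  cases n with
  | zero => simp
  | succ n => simp [PowerSeries.coeff_succ_mul_X, PowerSeries.coeff_mul_C, pow_succ,
      PowerSeries.coeff_one]

/-- The geometric series is a right inverse of `1 - a X`. -/
theorem one_sub_mul_mk_pow {A : Type*} [Ring A] (a : A) :
    (1 - PowerSeries.C a * PowerSeries.X) * (PowerSeries.mk fun n => a ^ n) = 1 := by
  ext n
  rw [sub_mul, one_mul, mul_assoc]
  cases n with
  | zero => simp
  | succ n => simp [PowerSeries.coeff_succ_X_mul, PowerSeries.coeff_C_mul, pow_succ',
      PowerSeries.coeff_one]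

theorem Uvar_mul_comm {A : Type*} [Ring A] (x : LaurentSeries A) :
    Uvar A * x = x * Uvar A := by
  ext n
  simp [Uvar, HahnSeries.coeff_single_mul, HahnSeries.coeff_mul_single]

theorem single_one_mul_Uvar {A : Type*} [Ring A] :
    HahnSeries.single (1 : ℤ) (1 : A) * Uvar A = 1 := by
  simp [Uvar, HahnSeries.single_mul_single]

theorem invU_eq {A : Type*} [Ring A] (a : A) :
    invU a = HahnSeries.ofPowerSeries ℤ A (PowerSeries.mk fun n => a ^ n) *
      HahnSeries.single (1 : ℤ) (1 : A) := by
  rw [invU, ← HahnSeries.ofPowerSeries_X, ← map_mul]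
  congr 1
  ext n
  cases n with
  | zero => simp
  | succ n => simp [PowerSeries.coeff_succ_mul_X]

theorem Uvar_sub_cst {A : Type*} [Ring A] (a : A) :
    Uvar A - cst a =
      Uvar A * HahnSeries.ofPowerSeries ℤ A (1 - PowerSeries.C a * PowerSeries.X) := by
  rw [map_sub, map_one, map_mul, HahnSeries.ofPowerSeries_C, HahnSeries.ofPowerSeries_X,
    Uvar_mul_comm, sub_mul, one_mul, mul_assoc, single_one_mul_Uvar, mul_one, cst]

theorem invU_mul_Uvar_sub {A : Type*} [Ring A] (a : A) :
    invU a * (Uvar A - cst a) = 1 := by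
  rw [invU_eq, Uvar_sub_cst, mul_assoc, ← mul_assoc (HahnSeries.single _ _),
    single_one_mul_Uvar, one_mul, ← map_mul, mk_pow_mul_one_sub, map_one]

theorem Uvar_sub_mul_invU {A : Type*} [Ring A] (a : A) :
    (Uvar A - cst a) * invU a = 1 := by
  rw [invU_eq, Uvar_sub_cst, ← mul_assoc, mul_assoc (Uvar A), ← map_mul, one_sub_mul_mk_pow,
    map_one, mul_one, Uvar_mul_comm, single_one_mul_Uvar]

theorem invU_mul_comm {A : Type*} [Ring A] {a b : A} (h : a * b = b * a) :
    invU a * invU b = invU b * invU a := by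
  have hc : (Uvar A - cst a) * (Uvar A - cst b) = (Uvar A - cst b) * (Uvar A - cst a) := by
    have : cst a * cst b = cst b * cst a := by simp only [cst, ← map_mul, h]
    simp only [sub_mul, mul_sub, this, Uvar_mul_comm (cst _)]
    abel
  refine left_inv_eq_right_inv (a := (Uvar A - cst b) * (Uvar A - cst a)) ?_ ?_
  · rw [mul_assoc, ← mul_assoc (invU b), invU_mul_Uvar_sub, one_mul, invU_mul_Uvar_sub]
  · rw [← hc, mul_assoc, ← mul_assoc (Uvar A - cst b), Uvar_sub_mul_invU, one_mul,
      Uvar_sub_mul_invU]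

/-- If `x a = 0` then `x / (2u - a) = x / (2u)`. -/
theorem cst_mul_inv2U (C : Type*) [CommRing C] [Invertible (2 : C)]
    {A : Type*} [Ring A] [Algebra C A] {x a : A} (h : x * a = 0) :
    cst x * inv2U C a = cst x * HahnSeries.single (1 : ℤ) (algebraMap C A ⅟2) := by
  have hs : HahnSeries.single (1 : ℤ) (algebraMap C A ⅟2) =
      HahnSeries.ofPowerSeries ℤ A (PowerSeries.C (algebraMap C A ⅟2) * PowerSeries.X) := by
    rw [map_mul, HahnSeries.ofPowerSeries_C, HahnSeries.ofPowerSeries_X, HahnSeries.C_apply,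
      HahnSeries.single_mul_single, zero_add, mul_one]
  rw [cst, inv2U, hs, ← HahnSeries.ofPowerSeries_C, ← map_mul, ← map_mul]
  congr 1
  ext n
  rcases n with _ | _ | n
  · simp
  · simp [PowerSeries.coeff_succ_mul_X, ← mul_assoc, Algebra.algebraMap_eq_smul_one]
  · simp [PowerSeries.coeff_succ_mul_X, ← mul_assoc, pow_succ' a, h]

/-- second intertwiner-like identity, degenerate case; (3.4) of the paper:
with `uⱼ⁺ = 1/(u-yⱼ)`, in formal Laurent series in `u⁻¹` over `𝓦ₖ` (0-indexed),
`(u_{i+1}⁺ + t_{sᵢ} - eᵢ/(2u-(yᵢ+y_{i+1}))) - uᵢ⁺ (u_{i+1}⁺ + t_{sᵢ} - eᵢ/(2u-(yᵢ+y_{i+1}))) uᵢ⁺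
 = (t_{sᵢ} uᵢ⁺ t_{sᵢ} + t_{sᵢ} - eᵢ/(2u-(yᵢ+y_{i+1})))
   - u_{i+1}⁺ (eᵢ uᵢ⁺ eᵢ + ε eᵢ - eᵢ/(2u-(yᵢ+y_{i+1}))) u_{i+1}⁺`. -/
theorem degenerate_affine_BMW_second_intertwiner
    (C : Type*) [CommRing C] [Invertible (2 : C)] (k : ℕ) (ε : C) (z₀ : ℕ → C)
    (A : Type*) [Ring A] [Algebra C A]
    (hk : 2 ≤ k) (hε : ε = 1 ∨ ε = -1)
    (B : DegAffBMW C k ε z₀ A) :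
    ∀ i (h : i + 1 < k),
      (invU (B.y (i + 1)) + cst (B.t (sw k i h)) -
            cst (B.e i h) * inv2U C (B.y i + B.y (i + 1))) -
        invU (B.y i) *
          (invU (B.y (i + 1)) + cst (B.t (sw k i h)) -
            cst (B.e i h) * inv2U C (B.y i + B.y (i + 1))) * invU (B.y i) =
      (cst (B.t (sw k i h)) * invU (B.y i) * cst (B.t (sw k i h)) + cst (B.t (sw k i h)) -
            cst (B.e i h) * inv2U C (B.y i + B.y (i + 1))) -
        invU (B.y (i + 1)) *
          (cst (B.e i h) * invU (B.y i) * cst (B.e i h) + ε • cst (B.e i h) -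
            cst (B.e i h) * inv2U C (B.y i + B.y (i + 1))) * invU (B.y (i + 1)) := by
  intro i h
  have hT : B.t (sw k i h) * B.t (sw k i h) = 1 := by
    rw [B.t_mul, sw, Equiv.swap_mul_self, B.t_one]
  have h2 : algebraMap C A ⅟2 + algebraMap C A ⅟2 = 1 := by
    rw [← map_add, ← two_mul, mul_invOf_self, map_one]
  rw [cst_mul_inv2U C (B.e_yy i h)]
  refine second_intertwiner_of_resolvents (U := Uvar A) (Uvar_mul_comm _) (Uvar_mul_comm _) ?_ ?_
    (Uvar_sub_mul_invU _) (invU_mul_Uvar_sub _) (Uvar_sub_mul_invU _) (invU_mul_Uvar_sub _)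
    (invU_mul_comm (B.y_comm _ _ (by omega) h)) ?_ ?_ ?_ ?_ ?_ ?_
  · rw [Uvar, HahnSeries.single_mul_single, ← HahnSeries.single_add, one_mul, h2, neg_add_cancel,
      HahnSeries.single_zero_one]
  · intro x
    ext n
    simp [HahnSeries.coeff_single_mul, HahnSeries.coeff_mul_single, Algebra.commutes]
  · simp only [cst, ← map_mul, hT, map_one]
  · simp only [cst, ← map_mul, ← map_sub, ← map_one (HahnSeries.C (Γ := ℤ) (R := A)), B.e_def]
  · simp only [cst, ← map_mul, B.e_t]
    ext n
    by_cases hn : n = 0 <;> simp [hn]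
  · simp only [cst, ← map_mul, B.t_e]
    ext n
    by_cases hn : n = 0 <;> simp [hn]
  · simp only [cst, ← map_mul, ← map_add, B.e_yy, map_zero]
  · simp only [cst, ← map_mul, ← map_add, B.yy_e, map_zero]
end

section
/- (Nazarov generating-function identity and centrality, degenerate case.) Assume 2 is invertible in C. Fix 1 ≤ i ≤ k−1 and suppose that for each ℓ ∈ ℤ_{≥0} there is an element z_{i−1}^{(ℓ)} in the subalgebra of 𝓦_k generated by t_{s_1},…,t_{s_{i−2}}, e_1,…,e_{i−2}, y_1,…,y_{i−1} such that e_i y_i^ℓ e_i = z_{i−1}^{(ℓ)} e_i. Then: (a) for every ℓ ∈ ℤ_{≥0}, the element e_i y_i^ℓ e_i of 𝓦_k commutes with t_{s_j} and e_j for 1 ≤ j ≤ i−2 and with y_j for 1 ≤ j ≤ i−1; and (b) setting z_{i−1}(u) = Σ_{ℓ≥0} z_{i−1}^{(ℓ)} u^{−ℓ}, the identity ( z_{i−1}(−u) − (1/2 + εu) )( z_{i−1}(u) − (1/2 − εu) ) e_i = (1/2 − εu)(1/2 + εu) e_i holds in the ring of formal Laurent series in u⁻¹ (with finitely many positive powers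 of u) over 𝓦_k. -/
section NazarovRecursion

open Finset

variable {A : Type*} [Ring A]

theorem mul_pow_succ_eq_sub_sum_antidiagonal {s y y' d : A} (hs : s * y = y' * s - d) (n : ℕ) :
    s * y ^ (n + 1) = y' ^ (n + 1) * s - ∑ p ∈ antidiagonal n, y' ^ p.1 * d * y ^ p.2 := by
  induction n with
  | zero => simpa using hs
  | succ n ih =>
    rw [pow_succ, ← mul_assoc, ih, Finset.Nat.antidiagonal_succ', sum_cons, sub_mul, sum_mul,
      mul_assoc, hs]
    simp only [sum_map, Function.Embedding.prodMap, Function.Embedding.coeFn_mk, Prod.map,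
      Function.Embedding.refl_apply, pow_succ, pow_zero, mul_one, mul_sub, mul_assoc,
      Nat.succ_eq_add_one]
    abel

theorem mul_pow_eq_neg_one_pow {e y y' : A} (hyy : Commute y y') (he : e * (y + y') = 0) (n : ℕ) :
    e * y' ^ n = (-1) ^ n * (e * y ^ n) := by
  have he' : e * y' = -(e * y) := by
    rw [mul_add] at he
    exact eq_neg_of_add_eq_zero_right he
  induction n with
  | zero => simp
  | succ n ih =>
    rw [pow_succ, ← mul_assoc, ih, mul_assoc, mul_assoc, (hyy.pow_left n).eq, ← mul_assoc e, he',
      pow_succ' y, pow_succ (-1 : A)]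
    simp only [mul_assoc, neg_mul, mul_neg, one_mul]

variable {C : Type*} [CommRing C] [Algebra C A]

theorem sub_mul_sub_mul_eq_of_mul_mul_eq {c ε : C} {U P Q E : A} (hU : Commute U P)
    (hPQ : P * Q * E = c • ((Q + P) * E) + ε • (U * ((Q - P) * E))) :
    (P - (c • 1 + ε • U)) * (Q - (c • 1 - ε • U)) * E =
      (c • 1 - ε • U) * (c • 1 + ε • U) * E := by
  have hPU := hU.eq
  simp only [sub_mul, mul_sub, add_mul, mul_add, smul_mul_assoc, mul_smul_comm, one_mul, mul_one,
    smul_add, smul_sub, ← mul_assoc, smul_comm ε c] at hPQ ⊢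
  rw [hPQ, ← hPU]
  abel

variable [Invertible (2 : C)]

theorem sum_antidiagonal_neg_one_pow (n : ℕ) :
    ∑ p ∈ antidiagonal n, (-1 : A) ^ p.1 = (⅟2 : C) • (1 + (-1 : A) ^ n) := by
  have h2 : ∑ p ∈ antidiagonal n, (-1 : A) ^ p.1 = if Even n then 1 else 0 := by
    rw [Finset.Nat.sum_antidiagonal_eq_sum_range_succ_mk]
    simp [neg_one_geom_sum, Nat.even_add_one, -Nat.not_even_iff_odd]
  rw [h2]
  split_ifs with hn
  · rw [hn.neg_one_pow, one_add_one_eq_two, ← map_ofNat (algebraMap C A) 2,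
      Algebra.algebraMap_eq_smul_one, smul_smul, invOf_mul_self, one_smul]
  · rw [(Nat.not_even_iff_odd.mp hn).neg_one_pow, add_neg_cancel, smul_zero]

theorem nazarov_recursion {ε : C} {s y y' e : A} {w : ℕ → A}
    (hs : s * y = y' * s - (1 - e)) (hes : e * s = ε • e) (hse : s * e = ε • e)
    (hyy : Commute y y') (he : e * (y + y') = 0)
    (hw : ∀ n, e * y ^ n * e = w n * e) (n : ℕ) :
    (∑ p ∈ antidiagonal n, (-1) ^ p.1 * w p.1 * w p.2) * e =
      (⅟2 : C) • ((w n + (-1) ^ n * w n) * e) +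
        ε • ((w (n + 1) - (-1) ^ (n + 1) * w (n + 1)) * e) := by
  have hsum : e * (∑ p ∈ antidiagonal n, y' ^ p.1 * (1 - e) * y ^ p.2) * e =
      (∑ p ∈ antidiagonal n, (-1 : A) ^ p.1) * (w n * e) -
        (∑ p ∈ antidiagonal n, (-1) ^ p.1 * w p.1 * w p.2) * e := by
    simp only [mul_sum, sum_mul, ← sum_sub_distrib]
    refine sum_congr rfl fun p hp => ?_
    rw [← mem_antidiagonal.mp hp, ← hw, mul_assoc _ (w p.2), ← hw p.2, mul_assoc ((-1) ^ p.1),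
      ← mul_assoc (w p.1), ← mul_assoc (w p.1), ← hw p.1, ← mul_assoc e, ← mul_assoc e,
      mul_pow_eq_neg_one_pow hyy he, pow_add]
    noncomm_ring
  have hl : e * (s * y ^ (n + 1)) * e = ε • (w (n + 1) * e) := by
    rw [← mul_assoc, hes, smul_mul_assoc, smul_mul_assoc, hw]
  have hr : e * (y' ^ (n + 1) * s) * e = ε • ((-1) ^ (n + 1) * w (n + 1) * e) := by
    rw [mul_assoc, mul_assoc, hse, mul_smul_comm, mul_smul_comm, ← mul_assoc,
      mul_pow_eq_neg_one_pow hyy he, mul_assoc, hw, mul_assoc]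
  have key := congrArg (fun x => e * x * e) (mul_pow_succ_eq_sub_sum_antidiagonal hs n)
  simp only [mul_sub e, sub_mul _ _ e] at key
  rw [hl, hr, hsum, sum_antidiagonal_neg_one_pow (C := C), smul_mul_assoc] at key
  rw [sub_mul, smul_sub, key, add_mul, add_mul, one_mul, mul_assoc ((-1) ^ n)]
  abel

theorem nazarov_powerSeries_identity {ε : C} {e : A} {w : ℕ → A}
    (hw : ∀ n, (∑ p ∈ antidiagonal n, (-1) ^ p.1 * w p.1 * w p.2) * e =
      (⅟2 : C) • ((w n + (-1) ^ n * w n) * e) +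
        ε • ((w (n + 1) - (-1) ^ (n + 1) * w (n + 1)) * e)) :
    PowerSeries.X * (PowerSeries.mk (fun n => (-1 : A) ^ n * w n) * PowerSeries.mk w *
        PowerSeries.C e) =
      PowerSeries.X * (PowerSeries.C (algebraMap C A ⅟2) *
        ((PowerSeries.mk w + PowerSeries.mk fun n => (-1 : A) ^ n * w n) * PowerSeries.C e)) +
      PowerSeries.C (algebraMap C A ε) *
        ((PowerSeries.mk w - PowerSeries.mk fun n => (-1 : A) ^ n * w n) * PowerSeries.C e) := by
  ext n
  cases n with
  | zero => simp
  | succ n =>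
    simp only [PowerSeries.coeff_succ_X_mul, map_add, PowerSeries.coeff_mul_C,
      PowerSeries.coeff_C_mul, PowerSeries.coeff_mk, map_sub]
    rw [PowerSeries.coeff_mul]
    simp only [PowerSeries.coeff_mk]
    simpa only [Algebra.smul_def] using hw n

end NazarovRecursion

theorem Uvar_mul_ofPowerSeries_X (A : Type*) [Ring A] :
    Uvar A * HahnSeries.ofPowerSeries ℤ A PowerSeries.X = 1 := by
  rw [HahnSeries.ofPowerSeries_X, Uvar, HahnSeries.single_mul_single]
  simp

theorem commute_Uvar {A : Type*} [Ring A] (x : LaurentSeries A) : Commute (Uvar A) x := by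
  ext n
  have h1 := HahnSeries.coeff_single_mul_add (r := (1 : A)) (x := x) (a := n + 1) (b := (-1 : ℤ))
  have h2 := HahnSeries.coeff_mul_single_add (r := (1 : A)) (x := x) (a := n + 1) (b := (-1 : ℤ))
  rw [add_neg_cancel_right] at h1 h2
  simp only [Uvar, h1, h2, one_mul, mul_one]

namespace DegAffBMW

variable {C : Type*} [CommRing C] {k : ℕ} {ε : C} {z₀ : ℕ → C} {A : Type*} [Ring A] [Algebra C A]
  (B : DegAffBMW C k ε z₀ A)

theorem commute_t_t {i j : ℕ} (hi : i + 1 < k) (hj : j + 1 < k) (hji : j + 2 ≤ i) :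
    Commute (B.t (sw k i hi)) (B.t (sw k j hj)) := by
  rw [Commute, SemiconjBy, B.t_mul, B.t_mul]
  congr 1
  refine (Equiv.Perm.disjoint_swap_swap ?_).commute
  simp
  omega

theorem commute_y_t {i j : ℕ} (hi : i < k) (hj : j + 1 < k) (hij : i ≠ j) (hij' : i ≠ j + 1) :
    Commute (B.y i) (B.t (sw k j hj)) :=
  B.y_t j i hj hi hij hij'

theorem e_eq {i : ℕ} (hi : i + 1 < k) :
    B.e i hi = 1 - (B.y (i + 1) * B.t (sw k i hi) - B.t (sw k i hi) * B.y i) := by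
  rw [B.e_def i hi]
  abel

theorem commute_e_of_commute {i : ℕ} (hi : i + 1 < k) {x : A} (ht : Commute x (B.t (sw k i hi)))
    (hy : Commute x (B.y i)) (hy' : Commute x (B.y (i + 1))) : Commute x (B.e i hi) := by
  rw [B.e_eq]
  exact (Commute.one_right x).sub_right ((hy'.mul_right ht).sub_right (ht.mul_right hy))

theorem commute_y_e {i j : ℕ} (hi : i < k) (hj : j + 1 < k) (hij : i ≠ j) (hij' : i ≠ j + 1) :
    Commute (B.y i) (B.e j hj) :=
  B.commute_e_of_commute hj (B.commute_y_t hi hj hij hij') (B.y_comm _ _ hi (by omega))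
    (B.y_comm _ _ hi hj)

theorem commute_e_t {i j : ℕ} (hi : i + 1 < k) (hj : j + 1 < k) (hji : j + 2 ≤ i) :
    Commute (B.e i hi) (B.t (sw k j hj)) :=
  (B.commute_e_of_commute hi (B.commute_t_t hi hj hji).symm
    (B.commute_y_t (by omega) hj (by omega) (by omega)).symm
    (B.commute_y_t hi hj (by omega) (by omega)).symm).symm

theorem commute_e_e {i j : ℕ} (hi : i + 1 < k) (hj : j + 1 < k) (hji : j + 2 ≤ i) :
    Commute (B.e i hi) (B.e j hj) :=
  B.commute_e_of_commute hj (B.commute_e_t hi hj hji)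
    (B.commute_y_e (by omega) hi (by omega) (by omega)).symm
    (B.commute_y_e hj hi (by omega) (by omega)).symm

end DegAffBMW

/-- Nazarov generating-function identity and centrality, degenerate case;
Theorem 3.2, (3.6) of the paper.  All indices are 0-indexed: the paper's `e_i`, `z_{i-1}`
(for a fixed `1 ≤ i ≤ k-1`) correspond to `e i₀ _`, `zc` with `i₀ = i - 1`; the paper's
generators `t_{s_1},…,t_{s_{i-2}}, e_1,…,e_{i-2}` are those `t (sw k j _), e j _` with
`j + 2 ≤ i₀`, and `y_1,…,y_{i-1}` are the `y j` with `j < i₀`. -/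
theorem degenerate_affine_BMW_generating_function
    (C : Type*) [CommRing C] [Invertible (2 : C)] (k : ℕ) (ε : C) (z₀ : ℕ → C)
    (A : Type*) [Ring A] [Algebra C A]
    (hk : 2 ≤ k) (hε : ε = 1 ∨ ε = -1)
    (B : DegAffBMW C k ε z₀ A)
    (i₀ : ℕ) (h : i₀ + 1 < k)
    (zc : ℕ → A)
    (hmem : ∀ ℓ, zc ℓ ∈ Algebra.adjoin C
      ({x : A | ∃ j, ∃ hj : j + 1 < k, j + 2 ≤ i₀ ∧ (x = B.t (sw k j hj) ∨ x = B.e j hj)} ∪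
        {x : A | ∃ j, j < i₀ ∧ x = B.y j}))
    (hz : ∀ ℓ : ℕ, B.e i₀ h * B.y i₀ ^ ℓ * B.e i₀ h = zc ℓ * B.e i₀ h) :
    -- (a) centrality of the elements `e_i y_i^ℓ e_i` in `𝓦_{i-1}`
    ((∀ ℓ j (hj : j + 1 < k), j + 2 ≤ i₀ →
        Commute (B.e i₀ h * B.y i₀ ^ ℓ * B.e i₀ h) (B.t (sw k j hj)) ∧
        Commute (B.e i₀ h * B.y i₀ ^ ℓ * B.e i₀ h) (B.e j hj)) ∧
      (∀ ℓ j, j < i₀ → Commute (B.e i₀ h * B.y i₀ ^ ℓ * B.e i₀ h) (B.y j))) ∧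
    -- (b) the identity `(z(-u) - (1/2 + εu))(z(u) - (1/2 - εu)) eᵢ = (1/2 - εu)(1/2 + εu) eᵢ`
    (HahnSeries.ofPowerSeries ℤ A (PowerSeries.mk fun ℓ => (-1 : A) ^ ℓ * zc ℓ) -
          ((⅟2 : C) • (1 : LaurentSeries A) + ε • Uvar A)) *
        (HahnSeries.ofPowerSeries ℤ A (PowerSeries.mk fun ℓ => zc ℓ) -
          ((⅟2 : C) • (1 : LaurentSeries A) - ε • Uvar A)) * cst (B.e i₀ h) =
      ((⅟2 : C) • (1 : LaurentSeries A) - ε • Uvar A) *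
        ((⅟2 : C) • (1 : LaurentSeries A) + ε • Uvar A) * cst (B.e i₀ h) := by
  refine ⟨⟨fun ℓ j hj hji => ⟨?_, ?_⟩, fun ℓ j hj => ?_⟩, ?_⟩
  · have he := B.commute_e_t h hj hji
    exact (he.mul_left ((B.commute_y_t (by omega) hj (by omega) (by omega)).pow_left ℓ)).mul_left he
  · have he := B.commute_e_e h hj hji
    exact (he.mul_left ((B.commute_y_e (by omega) hj (by omega) (by omega)).pow_left ℓ)).mul_left he
  · have he := (B.commute_y_e (i := j) (by omega) h (by omega) (by omega)).symm
    have hy : Commute (B.y i₀) (B.y j) := B.y_comm _ _ (by omega) (by omega)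
    exact (he.mul_left (hy.pow_left ℓ)).mul_left he
  · have key := congrArg (fun x => Uvar A * HahnSeries.ofPowerSeries ℤ A x)
      (nazarov_powerSeries_identity (nazarov_recursion (B.e_def i₀ h) (B.e_t i₀ h) (B.t_e i₀ h)
        (B.y_comm i₀ (i₀ + 1) (by omega) h) (B.e_yy i₀ h) hz))
    simp only [map_mul, map_add, map_sub, HahnSeries.ofPowerSeries_C, mul_add (Uvar A),
      ← mul_assoc (Uvar A), Uvar_mul_ofPowerSeries_X, one_mul] at key
    have hsmul (c : C) (x : LaurentSeries A) :
        HahnSeries.C (algebraMap C A c) * x = c • x := by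
      rw [HahnSeries.C_mul_eq_smul, algebraMap_smul]
    rw [(commute_Uvar (HahnSeries.C (algebraMap C A ε))).eq, mul_assoc _ (Uvar A)] at key
    simp only [hsmul] at key
    exact sub_mul_sub_mul_eq_of_mul_mul_eq (commute_Uvar _) key
end

section
/- In the affine BMW algebra W_k, for every 1 ≤ i ≤ k−1 and every ℓ ∈ ℤ_{≥0}: (i) T_i Y_i^ℓ = Y_{i+1}^ℓ T_i − (q−q⁻¹) Σ_{r=1}^{ℓ} Y_{i+1}^{ℓ−r+1}(1−E_i)Y_i^{r−1}; (ii) T_i Y_{i+1}^ℓ = Y_i^ℓ T_i + (q−q⁻¹) Σ_{r=1}^{ℓ} Y_i^{ℓ−r}(1−E_i)Y_{i+1}^{r}; (iii) T_i Y_i^{−ℓ} = Y_{i+1}^{−ℓ} T_i + (q−q⁻¹) Σ_{r=1}^{ℓ} Y_{i+1}^{−(ℓ−r)}(1−E_i)Y_i^{−r}; (iv) T_i Y_{i+1}^{−ℓ} = Y_i^{−ℓ} T_i − (q−q⁻¹) Σ_{r=1}^{ℓ} Y_i^{−(ℓ−r+1)}(1−E_i)Y_{i+1}^{−(r−1)}.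 -/
/-- A `C`-algebra `A` together with elements satisfying the defining relations of the
affine BMW algebra `W_k` with parameters `q, z ∈ Cˣ` and `Z₀⁽ℓ⁾ ∈ C` (`ℓ ∈ ℤ`).
Indexing is 0-based: the paper's `T_i, E_i` (for `1 ≤ i ≤ k-1`) are `T (i-1) _, E (i-1) _`
here, and the paper's `Y_i` (for `1 ≤ i ≤ k`) is `Y (i-1)`.  The fields `Y_zero`, `Y_succ`
say `Y₁ = z X^{ε₁}`, `Y_{i+1} = T_i Y_i T_i`, and `E_def` is the equation
`T_i Y_i = Y_{i+1} T_i - (q - q⁻¹) Y_{i+1} (1 - E_i)` defining `E_i`. -/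
structure AffBMW (C : Type*) [CommRing C] (k : ℕ) (q z : Cˣ) (Z₀ : ℤ → C)
    (A : Type*) [Ring A] [Algebra C A] where
  T : ∀ i : ℕ, i + 1 < k → A
  Tinv : ∀ i : ℕ, i + 1 < k → A
  X : A
  E : ∀ i : ℕ, i + 1 < k → A
  Y : ℕ → A
  Yinv : ℕ → A
  T_Tinv : ∀ i (h : i + 1 < k), T i h * Tinv i h = 1
  Tinv_T : ∀ i (h : i + 1 < k), Tinv i h * T i h = 1
  braid_far : ∀ i j (hi : i + 1 < k) (hj : j + 1 < k), i + 2 ≤ j →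
      T i hi * T j hj = T j hj * T i hi
  braid : ∀ i (h : i + 2 < k),
      T i (by omega) * T (i + 1) h * T i (by omega) =
        T (i + 1) h * T i (by omega) * T (i + 1) h
  XTXT : ∀ h : 1 < k, X * T 0 h * X * T 0 h = T 0 h * X * T 0 h * X
  X_T : ∀ i (h : i + 1 < k), 1 ≤ i → X * T i h = T i h * X
  Y_zero : Y 0 = (z : C) • X
  Y_succ : ∀ i (h : i + 1 < k), Y (i + 1) = T i h * Y i * T i h
  Y_Yinv : ∀ i, i < k → Y i * Yinv i = 1
  Yinv_Y : ∀ i, i < k → Yinv i * Y i = 1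
  E_def : ∀ i (h : i + 1 < k),
      T i h * Y i =
        Y (i + 1) * T i h -
          ((q : C) - ((q⁻¹ : Cˣ) : C)) • (Y (i + 1) * (1 - E i h))
  E_T : ∀ i (h : i + 1 < k), E i h * T i h = ((z⁻¹ : Cˣ) : C) • E i h
  T_E : ∀ i (h : i + 1 < k), T i h * E i h = ((z⁻¹ : Cˣ) : C) • E i h
  E_Tinv : ∀ i (h : i + 1 < k), E i h * Tinv i h = (z : C) • E i h
  Tinv_E : ∀ i (h : i + 1 < k), Tinv i h * E i h = (z : C) • E i h
  ETE_up : ∀ i (h : i + 1 < k) (h' : i + 2 < k),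
      E i h * T (i + 1) h' * E i h = (z : C) • E i h
  ETinvE_up : ∀ i (h : i + 1 < k) (h' : i + 2 < k),
      E i h * Tinv (i + 1) h' * E i h = ((z⁻¹ : Cˣ) : C) • E i h
  ETE_down : ∀ i (h : i + 1 < k) (h' : i - 1 + 1 < k), 1 ≤ i →
      E i h * T (i - 1) h' * E i h = (z : C) • E i h
  ETinvE_down : ∀ i (h : i + 1 < k) (h' : i - 1 + 1 < k), 1 ≤ i →
      E i h * Tinv (i - 1) h' * E i h = ((z⁻¹ : Cˣ) : C) • E i h
  EYE : ∀ (h : 1 < k) (ℓ : ℤ),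
      E 0 h * (if 0 ≤ ℓ then Y 0 ^ ℓ.toNat else Yinv 0 ^ (-ℓ).toNat) * E 0 h =
        Z₀ ℓ • E 0 h
  E_YY : ∀ i (h : i + 1 < k), E i h * (Y i * Y (i + 1)) = E i h
  YY_E : ∀ i (h : i + 1 < k), (Y i * Y (i + 1)) * E i h = E i h

/-- If `t` moves `a` past to `b` up to the error `c b e`, it moves `a ^ n` past to `b ^ n` up to
a geometric sum. -/
theorem mul_pow_eq_sub_smul_sum {R A : Type*} [CommRing R] [Ring A] [Algebra R A]
    {t a b e : A} {c : R} (h : t * a = b * t - c • (b * e)) (n : ℕ) :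
    t * a ^ n = b ^ n * t - c • ∑ r ∈ Finset.range n, b ^ (n - r) * e * a ^ r := by
  induction n with
  | zero => simp
  | succ n ih =>
    rw [pow_succ, ← mul_assoc, ih, sub_mul, mul_assoc, h, Finset.sum_range_succ',
      smul_mul_assoc, Finset.sum_mul]
    simp only [mul_sub, mul_smul_comm, smul_add, ← mul_assoc, pow_succ, Nat.add_sub_add_right,
      pow_zero, mul_one, Nat.sub_zero]
    abel

/-- If `t` moves `a` past to `b` up to the error `c e a`, it moves `a ^ n` past to `b ^ n` up to
a geometric sum. -/
theorem mul_pow_eq_add_smul_sum {R A : Type*} [CommRing R] [Ring A] [Algebra R A]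
    {t a b e : A} {c : R} (h : t * a = b * t + c • (e * a)) (n : ℕ) :
    t * a ^ n =
      b ^ n * t + c • ∑ r ∈ Finset.range n, b ^ (n - 1 - r) * e * a ^ (r + 1) := by
  induction n with
  | zero => simp
  | succ n ih =>
    have hexp (r : ℕ) : n - 1 - r = n - (r + 1) := by omega
    rw [pow_succ, ← mul_assoc, ih, add_mul, mul_assoc, h, Finset.sum_range_succ',
      smul_mul_assoc, Finset.sum_mul]
    simp only [mul_add, mul_smul_comm, smul_add, ← mul_assoc, pow_succ, Nat.add_sub_cancel,
      pow_zero, one_mul, Nat.sub_zero, hexp]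
    abel

namespace AffBMW

variable {C : Type*} [CommRing C] {k : ℕ} {q z : Cˣ} {Z₀ : ℤ → C} {A : Type*} [Ring A]
  [Algebra C A] (B : AffBMW C k q z Z₀ A) {i : ℕ} (h : i + 1 < k)

theorem T_mul_Y : B.T i h * B.Y i = B.Y (i + 1) * B.Tinv i h := by
  rw [B.Y_succ i h, mul_assoc, B.T_Tinv, mul_one]

theorem Tinv_mul_Y_succ : B.Tinv i h * B.Y (i + 1) = B.Y i * B.T i h := by
  rw [B.Y_succ i h, mul_assoc, ← mul_assoc (B.Tinv i h), B.Tinv_T, one_mul]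

theorem Tinv_mul_Yinv : B.Tinv i h * B.Yinv i = B.Yinv (i + 1) * B.T i h :=
  calc B.Tinv i h * B.Yinv i
      = B.Yinv (i + 1) * (B.Y (i + 1) * B.Tinv i h) * B.Yinv i := by
        rw [← mul_assoc, B.Yinv_Y _ h, one_mul]
    _ = B.Yinv (i + 1) * B.T i h := by
        rw [← B.T_mul_Y, mul_assoc, mul_assoc, B.Y_Yinv _ (by omega), mul_one]

theorem T_mul_Yinv_succ : B.T i h * B.Yinv (i + 1) = B.Yinv i * B.Tinv i h :=
  calc B.T i h * B.Yinv (i + 1)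
      = B.Yinv i * (B.Y i * B.T i h) * B.Yinv (i + 1) := by
        rw [← mul_assoc, B.Yinv_Y _ (by omega), one_mul]
    _ = B.Yinv i * B.Tinv i h := by
        rw [← B.Tinv_mul_Y_succ, mul_assoc, mul_assoc, B.Y_Yinv _ h, mul_one]

/-- The skein relation. -/
theorem Tinv_eq :
    B.Tinv i h = B.T i h - ((q : C) - ((q⁻¹ : Cˣ) : C)) • (1 - B.E i h) := by
  have hY := congrArg (B.Yinv (i + 1) * ·) ((B.T_mul_Y h).symm.trans (B.E_def i h))
  simpa only [← mul_smul_comm, ← mul_sub, ← mul_assoc, B.Yinv_Y _ h, one_mul] using hY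

theorem T_eq :
    B.T i h = B.Tinv i h + ((q : C) - ((q⁻¹ : Cˣ) : C)) • (1 - B.E i h) := by
  rw [B.Tinv_eq, sub_add_cancel]

end AffBMW

/-- the relations (3.40)–(3.43) in the affine BMW algebra `W_k`
(0-indexed; sums below run over `r ∈ Finset.range ℓ`, corresponding to `r-1` in (i), (iv)
and to `r` shifted in (ii), (iii) of the paper's `Σ_{r=1}^{ℓ}`):
(i) `Tᵢ Yᵢ^ℓ = Y_{i+1}^ℓ Tᵢ - (q-q⁻¹) Σ_{r=1}^{ℓ} Y_{i+1}^{ℓ-r+1} (1-Eᵢ) Yᵢ^{r-1}`;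
(ii) `Tᵢ Y_{i+1}^ℓ = Yᵢ^ℓ Tᵢ + (q-q⁻¹) Σ_{r=1}^{ℓ} Yᵢ^{ℓ-r} (1-Eᵢ) Y_{i+1}^{r}`;
(iii) `Tᵢ Yᵢ^{-ℓ} = Y_{i+1}^{-ℓ} Tᵢ + (q-q⁻¹) Σ_{r=1}^{ℓ} Y_{i+1}^{-(ℓ-r)} (1-Eᵢ) Yᵢ^{-r}`;
(iv) `Tᵢ Y_{i+1}^{-ℓ} = Yᵢ^{-ℓ} Tᵢ - (q-q⁻¹) Σ_{r=1}^{ℓ} Yᵢ^{-(ℓ-r+1)} (1-Eᵢ) Y_{i+1}^{-(r-1)}`. -/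
theorem affine_BMW_T_power_Y
    (C : Type*) [CommRing C] (k : ℕ) (q z : Cˣ) (Z₀ : ℤ → C)
    (A : Type*) [Ring A] [Algebra C A]
    [Invertible ((q : C) - ((q⁻¹ : Cˣ) : C))]
    (hk : 2 ≤ k)
    (B : AffBMW C k q z Z₀ A) :
    ∀ i (h : i + 1 < k) (ℓ : ℕ),
      B.T i h * B.Y i ^ ℓ =
          B.Y (i + 1) ^ ℓ * B.T i h -
            ((q : C) - ((q⁻¹ : Cˣ) : C)) •
              ∑ r ∈ Finset.range ℓ,
                B.Y (i + 1) ^ (ℓ - r) * (1 - B.E i h) * B.Y i ^ r ∧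
      B.T i h * B.Y (i + 1) ^ ℓ =
          B.Y i ^ ℓ * B.T i h +
            ((q : C) - ((q⁻¹ : Cˣ) : C)) •
              ∑ r ∈ Finset.range ℓ,
                B.Y i ^ (ℓ - 1 - r) * (1 - B.E i h) * B.Y (i + 1) ^ (r + 1) ∧
      B.T i h * B.Yinv i ^ ℓ =
          B.Yinv (i + 1) ^ ℓ * B.T i h +
            ((q : C) - ((q⁻¹ : Cˣ) : C)) •
              ∑ r ∈ Finset.range ℓ,
                B.Yinv (i + 1) ^ (ℓ - 1 - r) * (1 - B.E i h) * B.Yinv i ^ (r + 1) ∧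
      B.T i h * B.Yinv (i + 1) ^ ℓ =
          B.Yinv i ^ ℓ * B.T i h -
            ((q : C) - ((q⁻¹ : Cˣ) : C)) •
              ∑ r ∈ Finset.range ℓ,
                B.Yinv i ^ (ℓ - r) * (1 - B.E i h) * B.Yinv (i + 1) ^ r := by
  intro i h ℓ
  refine ⟨mul_pow_eq_sub_smul_sum (B.E_def i h) ℓ, mul_pow_eq_add_smul_sum ?_ ℓ,
    mul_pow_eq_add_smul_sum ?_ ℓ, mul_pow_eq_sub_smul_sum ?_ ℓ⟩
  · rw [← B.Tinv_mul_Y_succ, ← smul_mul_assoc, ← add_mul, ← B.T_eq]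
  · rw [← B.Tinv_mul_Yinv, ← smul_mul_assoc, ← add_mul, ← B.T_eq]
  · rw [← mul_smul_comm, ← mul_sub, ← B.Tinv_eq, B.T_mul_Yinv_succ]
end
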